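/- Let ε ∈ (0, 1/2]. For every (x, y) ∈ ℝ² satisfying the three linear inequalities x ≤ q(ε), y ≥ q(1 − ε), and x − y ≤ 2·q(ε/2), one has Φ(y) − Φ(x) ≥ 1 − 1.25ε. That is, the 'three-cut' polyhedron B_ε = {(x,y) : x ≤ q(ε), y ≥ q(1−ε), x − y ≤ 2q(ε/2)} satisfies S_ε ⊂ B_ε ⊂ S_{1.25ε}, so the family B_ε forms a 1.25-approximation of S_ε. -/

import Mathlib

open MeasureTheory ProbabilityTheory Set

/-- The standard Gaussian CDF. -/
noncomputable def Phi (t : ℝ) : ℝ := ((gaussianReal 0 1) (Set.Iic t)).toReal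

theorem Phi_eq_setIntegral (t : ℝ) : Phi t = ∫ s in Iic t, gaussianPDFReal 0 1 s := by
  rw [Phi, gaussianReal_apply_eq_integral 0 one_ne_zero,
    ENNReal.toReal_ofReal (integral_nonneg fun s => gaussianPDFReal_nonneg 0 1 s)]

theorem Phi_eq_setIntegral_Iic_zero (t : ℝ) :
    Phi t = ∫ s in Iic (0 : ℝ), gaussianPDFReal (-t) 1 s := by
  have hmap : (gaussianReal 0 1).map (· - t) = gaussianReal (-t) 1 := by
    simpa using gaussianReal_map_sub_const (μ := 0) (v := 1) t
  have h : gaussianReal 0 1 (Iic t) = gaussianReal (-t) 1 (Iic 0) := by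
    rw [← hmap, Measure.map_apply (by fun_prop) measurableSet_Iic]
    congr 1
    ext s
    simp
  rw [Phi, h, gaussianReal_apply_eq_integral (-t) one_ne_zero,
    ENNReal.toReal_ofReal (integral_nonneg fun s => gaussianPDFReal_nonneg (-t) 1 s)]

theorem Phi_nonneg (t : ℝ) : 0 ≤ Phi t := ENNReal.toReal_nonneg

theorem Phi_mono : Monotone Phi := fun _ _ h =>
  ENNReal.toReal_mono (measure_ne_top _ _) (measure_mono (Iic_subset_Iic.2 h))

theorem Phi_neg (t : ℝ) : Phi (-t) = 1 - Phi t := by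
  have hmap : (gaussianReal 0 1).map (fun s => -s) = gaussianReal 0 1 := by
    simpa using gaussianReal_map_neg (μ := 0) (v := 1)
  have : NullSingletonClass (gaussianReal 0 1) :=
    nullSingletonClass_gaussianReal one_ne_zero
  have h : gaussianReal 0 1 (Iic (-t)) = gaussianReal 0 1 (Iic t)ᶜ := by
    conv_lhs => rw [← hmap]
    rw [Measure.map_apply (by fun_prop) measurableSet_Iic, compl_Iic]
    have : (fun s : ℝ => -s) ⁻¹' Iic (-t) = Ici t := by
      ext s
      simp
    rw [this]
    exact measure_congr Ioi_ae_eq_Ici.symm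
  rw [Phi, Phi, h]
  exact probReal_compl_eq_one_sub (μ := gaussianReal 0 1) measurableSet_Iic

theorem hasDerivAt_Phi (t : ℝ) : HasDerivAt Phi (gaussianPDFReal 0 1 t) t := by
  have hint := integrable_gaussianPDFReal 0 1
  have hcont : Continuous (gaussianPDFReal 0 1) := by
    unfold gaussianPDFReal
    fun_prop
  have h : Phi = fun u => Phi 0 + ∫ s in (0 : ℝ)..u, gaussianPDFReal 0 1 s := by
    ext u
    rw [← intervalIntegral.integral_Iic_sub_Iic hint.integrableOn hint.integrableOn,
      Phi_eq_setIntegral, Phi_eq_setIntegral]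
    ring
  rw [h]
  exact (hcont.integral_hasStrictDerivAt 0 t).hasDerivAt.const_add _

/-- The ratio of the Gaussian CDF to the Gaussian density is nondecreasing. -/
theorem gaussianPDFReal_mul_Phi_le {a b : ℝ} (hab : a ≤ b) :
    gaussianPDFReal 0 1 b * Phi a ≤ gaussianPDFReal 0 1 a * Phi b := by
  rw [Phi_eq_setIntegral_Iic_zero a, Phi_eq_setIntegral_Iic_zero b, ← integral_const_mul,
    ← integral_const_mul]
  refine setIntegral_mono_on ((integrable_gaussianPDFReal _ _).const_mul _).integrableOn
    ((integrable_gaussianPDFReal _ _).const_mul _).integrableOn measurableSet_Iic fun s hs => ?_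
  have hs : s ≤ 0 := hs
  simp only [gaussianPDFReal, NNReal.coe_one]
  rw [mul_mul_mul_comm, mul_mul_mul_comm _ (Real.exp (-(a - 0) ^ 2 / _)), ← Real.exp_add, ← Real.exp_add]
  gcongr _ * Real.exp ?_
  nlinarith [mul_nonneg (neg_nonneg.2 hs) (sub_nonneg.2 hab)]

/-- Midpoint log-concavity of the Gaussian CDF. -/
theorem Phi_sub_mul_Phi_add_le (m h : ℝ) : Phi (m - h) * Phi (m + h) ≤ Phi m ^ 2 := by
  wlog hh : 0 ≤ h generalizing h
  · simpa [mul_comm, sub_eq_add_neg] using this (-h) (by linarith)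
  have hderiv (k : ℝ) : HasDerivAt (fun k => Phi (m - k) * Phi (m + k))
      (-gaussianPDFReal 0 1 (m - k) * Phi (m + k) +
        Phi (m - k) * gaussianPDFReal 0 1 (m + k)) k := by
    have h₁ : HasDerivAt (fun k => Phi (m - k)) (-gaussianPDFReal 0 1 (m - k)) k :=
      (hasDerivAt_Phi (m - k)).comp_const_sub m k
    exact h₁.mul ((hasDerivAt_Phi (m + k)).comp_const_add m k)
  have hanti : AntitoneOn (fun k => Phi (m - k) * Phi (m + k)) (Ici 0) := by
    refine antitoneOn_of_deriv_nonpos (convex_Ici 0)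
      (fun k _ => (hderiv k).continuousAt.continuousWithinAt)
      (fun k _ => (hderiv k).differentiableAt.differentiableWithinAt) fun k hk => ?_
    rw [interior_Ici] at hk
    have hk : 0 < k := hk
    rw [(hderiv k).deriv]
    linarith [gaussianPDFReal_mul_Phi_le (show m - k ≤ m + k by linarith)]
  simpa [sq] using hanti (mem_Ici.2 le_rfl) (mem_Ici.2 hh) hh

/-- The "three-cut" polyhedron `B_ε` forms a 1.25-approximation of `S_ε`: every point
satisfying `x ≤ q(ε)`, `y ≥ q(1−ε)` and `x − y ≤ 2q(ε/2)` has `Φ(y) − Φ(x) ≥ 1 − 1.25ε`.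
Here `q` is the standard Gaussian quantile function. -/
theorem stmt15 (q : ℝ → ℝ) (hq : ∀ p ∈ Set.Ioo (0 : ℝ) 1, Phi (q p) = p)
    (ε : ℝ) (hε0 : 0 < ε) (hε : ε ≤ 1 / 2) :
    ∀ x y : ℝ, x ≤ q ε → q (1 - ε) ≤ y → x - y ≤ 2 * q (ε / 2) →
      Phi y - Phi x ≥ 1 - 1.25 * ε := by
  intro x y hx hy hxy
  have hΦx : Phi x ≤ ε := (Phi_mono hx).trans_eq (hq ε ⟨hε0, by linarith⟩)
  have hΦy : Phi (-y) ≤ ε := by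
    have := Phi_mono hy
    rw [hq (1 - ε) ⟨by linarith, by linarith⟩] at this
    linarith [Phi_neg y]
  have hmid : Phi ((x - y) / 2) ≤ ε / 2 :=
    (Phi_mono (by linarith)).trans_eq (hq (ε / 2) ⟨by linarith, by linarith⟩)
  have hprod : Phi x * Phi (-y) ≤ (ε / 2) ^ 2 := by
    have h := Phi_sub_mul_Phi_add_le ((x - y) / 2) (-(x + y) / 2)
    rw [show (x - y) / 2 - -(x + y) / 2 = x by ring,
      show (x - y) / 2 + -(x + y) / 2 = -y by ring] at h
    exact h.trans (pow_le_pow_left₀ (Phi_nonneg _) hmid 2)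
  have hsum : Phi x + Phi (-y) ≤ 1.25 * ε := by
    refine le_of_mul_le_mul_left ?_ hε0
    nlinarith [mul_nonneg (sub_nonneg.2 hΦx) (sub_nonneg.2 hΦy)]
  linarith [Phi_neg y]
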